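/- arXiv:1311.7556 — 2 statements merged into one kernel-verified Lean document; each statement's English description precedes it below -/
import Mathlib

section
/- For each fixed α ∈ [1,2] there is a constant C such that for all real y ≥ 2: |∑_{n ≤ y^α, P⁺(n) > y} 1/n − (α·log α − α + 1)·log y| ≤ C, where the sum runs over integers n ≥ 2 up to y^α whose largest prime factor exceeds y. -/
open Real Finset

/-- `P⁺(n)`: the largest prime factor of `n` (with `P⁺(1) = 0`). -/
def Pplus (n : ℕ) : ℕ := n.primeFactors.sup id

/-- The weight `log p / p` at primes `p`, and `0` elsewhere. -/
noncomputable def primeWeight (k : ℕ) : ℝ := if k.Prime then Real.log k / k else 0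

theorem log_factorial_eq_sum_factorization (n : ℕ) :
    Real.log (n.factorial : ℝ) =
      ∑ k ∈ Finset.Icc 0 n, (n.factorial.factorization k : ℝ) * Real.log k := by
  rw [Real.log_nat_eq_sum_factorization]
  refine Finsupp.sum_of_support_subset _ ?_ _ (by simp)
  intro p hp
  rw [Nat.support_factorization, Nat.mem_primeFactors] at hp
  exact Finset.mem_Icc.2 ⟨Nat.zero_le _, (hp.1.dvd_factorial).1 hp.2.1⟩

theorem le_factorization_factorial {p : ℕ} (hp : p.Prime) (n : ℕ) :
    (n : ℝ) / p - 1 ≤ n.factorial.factorization p := by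
  have h : n / p ≤ n.factorial.factorization p := by
    rw [Nat.factorization_factorial hp (b := Nat.log p n + 2) (by lia)]
    refine le_trans (by simp) (Finset.single_le_sum (f := fun i => n / p ^ i)
      (fun _ _ => Nat.zero_le _) (Finset.mem_Icc.2 ⟨le_rfl, ?_⟩ : 1 ∈ Finset.Ico 1 _))
    lia
  have h' : (n : ℝ) / p < (n / p : ℕ) + 1 := by
    rw [← Nat.floor_div_eq_div (K := ℝ)]
    exact Nat.lt_floor_add_one _
  have : ((n / p : ℕ) : ℝ) ≤ n.factorial.factorization p := by exact_mod_cast h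
  linarith

theorem factorization_factorial_mul_log_le (n k : ℕ) :
    (n.factorial.factorization k : ℝ) * Real.log k ≤
      n * (primeWeight k + 4 * (k : ℝ) ^ (-(3 / 2) : ℝ)) := by
  unfold primeWeight
  split_ifs with hk
  · have hk2 : (2 : ℝ) ≤ k := by exact_mod_cast hk.two_le
    have hk0 : (0 : ℝ) < k := by linarith
    have h1 : (n.factorial.factorization k : ℝ) ≤ n / ((k : ℝ) - 1) := by
      have := Nat.factorization_factorial_le_div_pred hk n
      have h2 : ((n / (k - 1) : ℕ) : ℝ) ≤ n / ((k - 1 : ℕ) : ℝ) := Nat.cast_div_le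
      rw [Nat.cast_sub hk.one_le, Nat.cast_one] at h2
      exact le_trans (by exact_mod_cast this) h2
    have hlog : Real.log k ≤ 2 * (k : ℝ) ^ (1 / 2 : ℝ) := by
      have := Real.log_le_rpow_div hk0.le (ε := 1 / 2) (by norm_num)
      linarith
    have hlog0 : 0 ≤ Real.log k := Real.log_natCast_nonneg k
    have hpow : (k : ℝ) ^ (-(3 / 2) : ℝ) = (k : ℝ) ^ (1 / 2 : ℝ) / k ^ 2 := by
      rw [← Real.rpow_natCast, ← Real.rpow_sub hk0]
      norm_num
    have h3 : Real.log k / ((k : ℝ) - 1) ≤ Real.log k / k + 4 * (k : ℝ) ^ (-(3 / 2) : ℝ) := by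
      have : Real.log k / ((k : ℝ) - 1) = Real.log k / k + Real.log k / (k * (k - 1)) := by
        have : (k : ℝ) - 1 ≠ 0 := by linarith
        field_simp
        ring
      rw [this, hpow]
      gcongr
      rw [← mul_div_assoc, div_le_div_iff₀ (by nlinarith) (by positivity)]
      calc Real.log k * k ^ 2 ≤ (2 * (k : ℝ) ^ (1 / 2 : ℝ)) * (2 * (k * (k - 1))) := by
            gcongr
            nlinarith
        _ = _ := by ring
    calc (n.factorial.factorization k : ℝ) * Real.log k
        ≤ n / ((k : ℝ) - 1) * Real.log k := by gcongr
      _ = n * (Real.log k / ((k : ℝ) - 1)) := by ring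
      _ ≤ _ := by gcongr
  · rw [Nat.factorization_eq_zero_of_not_prime _ hk]
    simp only [Nat.cast_zero, zero_mul, zero_add]
    positivity

theorem le_factorization_factorial_mul_log (n k : ℕ) :
    n * primeWeight k - (if k.Prime then Real.log k else 0) ≤
      (n.factorial.factorization k : ℝ) * Real.log k := by
  unfold primeWeight
  split_ifs with hk
  · have := mul_le_mul_of_nonneg_right (le_factorization_factorial hk n)
      (Real.log_natCast_nonneg k)
    calc _ = ((n : ℝ) / k - 1) * Real.log k := by ring
      _ ≤ _ := this
  · have := Real.log_natCast_nonneg k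
    simp only [mul_zero, sub_zero]
    positivity

/-- Mertens' first theorem along the natural numbers. -/
theorem exists_abs_sum_primeWeight_sub_log_natCast_le :
    ∃ K : ℝ, ∀ n : ℕ, 1 ≤ n → |∑ k ∈ Finset.Icc 0 n, primeWeight k - Real.log n| ≤ K := by
  have hs : Summable fun k : ℕ => 4 * (k : ℝ) ^ (-(3 / 2) : ℝ) :=
    (Real.summable_nat_rpow.2 (by norm_num)).mul_left 4
  refine ⟨max (Real.log 4) (1 + ∑' k : ℕ, 4 * (k : ℝ) ^ (-(3 / 2) : ℝ)), fun n hn => ?_⟩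
  have hn0 : (0 : ℝ) < n := by exact_mod_cast hn
  have hfact : Real.log (n.factorial : ℝ) ≤ n * Real.log n := by
    rw [← Real.log_pow]
    refine Real.log_le_log (by exact_mod_cast n.factorial_pos) ?_
    exact_mod_cast Nat.factorial_le_pow n
  have hfact' : n * Real.log n - n ≤ Real.log (n.factorial : ℝ) := by
    have h := Real.pow_div_factorial_le_exp (n : ℝ) hn0.le n
    have h' := Real.log_le_log (by positivity) h
    rw [Real.log_exp, Real.log_div (by positivity) (by positivity), Real.log_pow] at h'
    linarith
  have hlow : n * ∑ k ∈ Finset.Icc 0 n, primeWeight k - Real.log 4 * n ≤ n * Real.log n := by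
    have hθ := Chebyshev.theta_le_log4_mul_x (x := n) hn0.le
    rw [Chebyshev.theta_eq_sum_Icc, Nat.floor_natCast, Finset.sum_filter] at hθ
    have := Finset.sum_le_sum fun k (_ : k ∈ Finset.Icc 0 n) =>
      le_factorization_factorial_mul_log n k
    rw [← log_factorial_eq_sum_factorization, Finset.sum_sub_distrib, ← Finset.mul_sum] at this
    linarith
  have hupp : n * Real.log n - n ≤ n * (∑ k ∈ Finset.Icc 0 n, primeWeight k +
      ∑' k : ℕ, 4 * (k : ℝ) ^ (-(3 / 2) : ℝ)) := by
    have := Finset.sum_le_sum fun k (_ : k ∈ Finset.Icc 0 n) =>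
      factorization_factorial_mul_log_le n k
    rw [← log_factorial_eq_sum_factorization, ← Finset.mul_sum, Finset.sum_add_distrib] at this
    have ht := hs.sum_le_tsum (Finset.Icc 0 n) (fun k _ => by positivity)
    calc _ ≤ _ := hfact'
      _ ≤ _ := this
      _ ≤ _ := by gcongr
  rw [abs_le]
  constructor
  · have : Real.log n - 1 ≤ ∑ k ∈ Finset.Icc 0 n, primeWeight k +
      ∑' k : ℕ, 4 * (k : ℝ) ^ (-(3 / 2) : ℝ) := by
      refine le_of_mul_le_mul_left ?_ hn0
      linarith
    linarith [le_max_right (Real.log 4) (1 + ∑' k : ℕ, 4 * (k : ℝ) ^ (-(3 / 2) : ℝ))]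
  · have : ∑ k ∈ Finset.Icc 0 n, primeWeight k - Real.log 4 ≤ Real.log n := by
      refine le_of_mul_le_mul_left ?_ hn0
      linarith
    linarith [le_max_left (Real.log 4) (1 + ∑' k : ℕ, 4 * (k : ℝ) ^ (-(3 / 2) : ℝ))]

/-- Mertens' first theorem. -/
theorem exists_abs_sum_primeWeight_sub_log_le :
    ∃ K : ℝ, ∀ t : ℝ, 1 ≤ t → |∑ k ∈ Finset.Icc 0 ⌊t⌋₊, primeWeight k - Real.log t| ≤ K := by
  obtain ⟨K, hK⟩ := exists_abs_sum_primeWeight_sub_log_natCast_le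
  refine ⟨K + Real.log 2, fun t ht => ?_⟩
  have hfl : 1 ≤ ⌊t⌋₊ := Nat.le_floor (by simpa using ht)
  have hfl' : (1 : ℝ) ≤ ⌊t⌋₊ := by exact_mod_cast hfl
  have h1 : Real.log ⌊t⌋₊ ≤ Real.log t :=
    Real.log_le_log (by linarith) (Nat.floor_le (by linarith))
  have h2 : Real.log t ≤ Real.log ⌊t⌋₊ + Real.log 2 := by
    rw [← Real.log_mul (by linarith) two_ne_zero]
    exact Real.log_le_log (by linarith) (by linarith [Nat.lt_floor_add_one t])
  have := abs_le.1 (hK _ hfl)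
  have := Real.log_nonneg one_le_two
  rw [abs_le]
  constructor <;> linarith

theorem hasDerivAt_div_log_sub_one (L : ℝ) {t : ℝ} (ht : 1 < t) :
    HasDerivAt (fun t => L / Real.log t - 1) (-L / (t * Real.log t ^ 2)) t := by
  have hl : Real.log t ≠ 0 := (Real.log_pos ht).ne'
  have h := (((Real.hasDerivAt_log (by linarith : t ≠ 0)).inv hl).const_mul L).sub_const 1
  refine h.congr_deriv ?_
  have : t ≠ 0 := by linarith
  field_simp

theorem integral_deriv_mul_log_add (L K : ℝ) {y X : ℝ} (hy : 1 < y) (hyX : y ≤ X) :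
    ∫ t in y..X, -L / (t * Real.log t ^ 2) * (Real.log t + K) =
      -L * (Real.log (Real.log X) - Real.log (Real.log y)) +
        K * (L / Real.log X - L / Real.log y) := by
  have key : ∀ t ∈ Set.uIcc y X,
      HasDerivAt (fun t => -L * Real.log (Real.log t) + K * (L / Real.log t - 1))
        (-L / (t * Real.log t ^ 2) * (Real.log t + K)) t := by
    intro t ht
    rw [Set.uIcc_of_le hyX] at ht
    have ht1 : 1 < t := hy.trans_le ht.1
    have ht0 : t ≠ 0 := by linarith
    have hl : Real.log t ≠ 0 := (Real.log_pos ht1).ne'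
    have h := (((Real.hasDerivAt_log ht0).log hl).const_mul (-L)).add
      ((hasDerivAt_div_log_sub_one L ht1).const_mul K)
    refine h.congr_deriv ?_
    field_simp
    ring
  rw [intervalIntegral.integral_eq_sub_of_hasDerivAt key]
  · ring
  · refine ContinuousOn.intervalIntegrable fun t ht => ContinuousAt.continuousWithinAt ?_
    rw [Set.uIcc_of_le hyX] at ht
    have ht1 : 1 < t := hy.trans_le ht.1
    have ht0 : t ≠ 0 := by linarith
    have hl : Real.log t ≠ 0 := (Real.log_pos ht1).ne'
    have : t * Real.log t ^ 2 ≠ 0 := by positivity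
    fun_prop (disch := assumption)

/-- Partial summation against Mertens' first theorem. -/
theorem abs_sum_div_log_sub_one_mul_primeWeight_sub_le {K : ℝ}
    (hK : ∀ t : ℝ, 1 ≤ t → |∑ k ∈ Finset.Icc 0 ⌊t⌋₊, primeWeight k - Real.log t| ≤ K)
    {y X : ℝ} (hy : 1 < y) (hyX : y ≤ X) :
    |∑ k ∈ Finset.Ioc ⌊y⌋₊ ⌊X⌋₊, (Real.log X / Real.log k - 1) * primeWeight k
        - (Real.log X * (Real.log (Real.log X) - Real.log (Real.log y))
          - (Real.log X - Real.log y))| ≤ 2 * K * (Real.log X / Real.log y - 1) := by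
  set L := Real.log X with hL
  have hly : 0 < Real.log y := Real.log_pos hy
  have hLy : Real.log y ≤ L := Real.log_le_log (by linarith) hyX
  have hL0 : 0 < L := hly.trans_le hLy
  have hderiv : ∀ t ∈ Set.Icc y X,
      deriv (fun t => L / Real.log t - 1) t = -L / (t * Real.log t ^ 2) :=
    fun t ht => (hasDerivAt_div_log_sub_one L (hy.trans_le ht.1)).deriv
  have hcont : ContinuousOn (fun t => -L / (t * Real.log t ^ 2)) (Set.Icc y X) := by
    refine fun t ht => ContinuousAt.continuousWithinAt ?_
    have ht1 : 1 < t := hy.trans_le ht.1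
    have ht0 : t ≠ 0 := by linarith
    have hl : Real.log t ≠ 0 := (Real.log_pos ht1).ne'
    have : t * Real.log t ^ 2 ≠ 0 := by positivity
    fun_prop (disch := assumption)
  have hlogc : ContinuousOn Real.log (Set.Icc y X) :=
    Real.continuousOn_log.mono fun t ht => by
      have : y ≤ t := ht.1
      simp only [Set.mem_compl_iff, Set.mem_singleton_iff]
      linarith
  have hint : MeasureTheory.IntegrableOn (fun t => -L / (t * Real.log t ^ 2)) (Set.Icc y X) :=
    hcont.integrableOn_Icc
  have habel := sum_mul_eq_sub_sub_integral_mul primeWeight (f := fun t => L / Real.log t - 1)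
    (by linarith : (0 : ℝ) ≤ y) hyX
    (fun t ht => (hasDerivAt_div_log_sub_one L (hy.trans_le ht.1)).differentiableAt)
    (hint.congr_fun (fun t ht => (hderiv t ht).symm) measurableSet_Icc)
  have hcongr : ∫ t in Set.Ioc y X, deriv (fun t => L / Real.log t - 1) t *
        ∑ k ∈ Finset.Icc 0 ⌊t⌋₊, primeWeight k =
      ∫ t in y..X, -L / (t * Real.log t ^ 2) * ∑ k ∈ Finset.Icc 0 ⌊t⌋₊, primeWeight k := by
    rw [intervalIntegral.integral_of_le hyX]
    refine MeasureTheory.setIntegral_congr_fun measurableSet_Ioc fun t ht => ?_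
    simp only [hderiv t (Set.Ioc_subset_Icc_self ht)]
  have hintS : IntervalIntegrable (fun t => -L / (t * Real.log t ^ 2) *
      ∑ k ∈ Finset.Icc 0 ⌊t⌋₊, primeWeight k) MeasureTheory.volume y X := by
    rw [intervalIntegrable_iff_integrableOn_Icc_of_le hyX]
    exact integrableOn_mul_sum_Icc primeWeight (by linarith) hint
  have hintK : ∀ K' : ℝ, IntervalIntegrable (fun t => -L / (t * Real.log t ^ 2) *
      (Real.log t + K')) MeasureTheory.volume y X := fun K' => by
    refine ContinuousOn.intervalIntegrable ?_
    rw [Set.uIcc_of_le hyX]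
    exact hcont.mul (hlogc.add continuousOn_const)
  have hneg : ∀ t ∈ Set.Icc y X, -L / (t * Real.log t ^ 2) ≤ 0 := fun t ht => by
    have : 0 < t := by linarith [ht.1]
    exact div_nonpos_of_nonpos_of_nonneg (by linarith) (by positivity)
  have hup := intervalIntegral.integral_mono_on hyX hintS (hintK (-K)) fun t ht =>
    mul_le_mul_of_nonpos_left
      (by linarith [(abs_le.1 (hK t (hy.le.trans ht.1))).1]) (hneg t ht)
  have hlo := intervalIntegral.integral_mono_on hyX (hintK K) hintS fun t ht =>
    mul_le_mul_of_nonpos_left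
      (by linarith [(abs_le.1 (hK t (hy.le.trans ht.1))).2]) (hneg t ht)
  rw [integral_deriv_mul_log_add L _ hy hyX] at hup hlo
  rw [hcongr] at habel
  have hKy := abs_le.1 (hK y hy.le)
  have hr : 0 ≤ L / Real.log y - 1 := by
    rw [sub_nonneg, one_le_div hly]
    exact hLy
  have h1 := mul_le_mul_of_nonneg_left hKy.1 hr
  have h2 := mul_le_mul_of_nonneg_left hKy.2 hr
  have hone : L / L = 1 := div_self hL0.ne'
  have hmain : (L / Real.log y - 1) * Real.log y = L - Real.log y := by
    field_simp
  rw [← hL, hone] at hup hlo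
  simp only [← hL, hone, sub_self, zero_mul, zero_sub] at habel
  rw [habel, abs_le]
  constructor <;> nlinarith

theorem Pplus_prime_mul {p m : ℕ} (hp : p.Prime) (hm : m ≠ 0) (hmp : m ≤ p) :
    Pplus (p * m) = p := by
  refine le_antisymm (Finset.sup_le fun q hq => ?_)
    (Finset.le_sup (f := id)
      (Nat.mem_primeFactors.2 ⟨hp, dvd_mul_right p m, mul_ne_zero hp.ne_zero hm⟩))
  · rw [Nat.mem_primeFactors] at hq
    rcases hq.1.dvd_mul.1 hq.2.1 with h | h
    · exact Nat.le_of_dvd hp.pos h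
    · exact (Nat.le_of_dvd (Nat.pos_of_ne_zero hm) h).trans hmp

theorem Pplus_mem_primeFactors {n : ℕ} (h : 0 < Pplus n) : Pplus n ∈ n.primeFactors := by
  have hne : n.primeFactors.Nonempty := by
    rw [Finset.nonempty_iff_ne_empty]
    intro h0
    simp [Pplus, h0] at h
  obtain ⟨q, hq, hq'⟩ := Finset.exists_mem_eq_sup _ hne id
  have : Pplus n = q := hq'
  rwa [this]

theorem sum_inv_filter_lt_Pplus {Y N : ℕ} (hN : N < (Y + 1) ^ 2) :
    ∑ n ∈ (Finset.Icc 2 N).filter (fun n => Y < Pplus n), (1 : ℝ) / n =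
      ∑ p ∈ (Finset.Ioc Y N).filter Nat.Prime, ∑ m ∈ Finset.Icc 1 (N / p),
        (1 : ℝ) / (p * m : ℕ) := by
  rw [Finset.sum_sigma']
  symm
  have key : ∀ p m : ℕ, p.Prime → Y < p → 1 ≤ m → m ≤ N / p → p * m ≤ N ∧ Pplus (p * m) = p := by
    intro p m hp hYp hm hmN
    have h1 : p * m ≤ N := by
      rw [mul_comm]
      exact (Nat.le_div_iff_mul_le hp.pos).1 hmN
    refine ⟨h1, Pplus_prime_mul hp (by lia) ?_⟩
    by_contra! h
    nlinarith
  refine Finset.sum_bij' (fun x _ => x.1 * x.2) (fun n _ => ⟨Pplus n, n / Pplus n⟩)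
    ?_ ?_ ?_ ?_ ?_
  · rintro ⟨p, m⟩ h
    simp only [Finset.mem_sigma, Finset.mem_filter, Finset.mem_Ioc, Finset.mem_Icc] at h ⊢
    obtain ⟨⟨⟨h1, h2⟩, hp⟩, h3, h4⟩ := h
    obtain ⟨h5, h6⟩ := key p m hp h1 h3 h4
    exact ⟨⟨by nlinarith [hp.two_le], h5⟩, by rwa [h6]⟩
  · intro n h
    simp only [Finset.mem_sigma, Finset.mem_filter, Finset.mem_Ioc, Finset.mem_Icc] at h ⊢
    have hP := Nat.mem_primeFactors.1 (Pplus_mem_primeFactors (by lia : 0 < Pplus n))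
    have hle := Nat.le_of_dvd (by lia) hP.2.1
    exact ⟨⟨⟨h.2, by lia⟩, hP.1⟩, Nat.div_pos hle hP.1.pos, Nat.div_le_div_right h.1.2⟩
  · rintro ⟨p, m⟩ h
    simp only [Finset.mem_sigma, Finset.mem_filter, Finset.mem_Ioc, Finset.mem_Icc] at h
    obtain ⟨⟨⟨h1, h2⟩, hp⟩, h3, h4⟩ := h
    simp only [(key p m hp h1 h3 h4).2, Nat.mul_div_cancel_left m hp.pos]
  · intro n h
    simp only [Finset.mem_filter] at h
    have hP := Nat.mem_primeFactors.1 (Pplus_mem_primeFactors (by lia : 0 < Pplus n))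
    exact Nat.mul_div_cancel' hP.2.1
  · intro x _
    rfl

theorem sum_one_div_Icc_eq_harmonic (n : ℕ) :
    ∑ m ∈ Finset.Icc 1 n, (1 : ℝ) / m = harmonic n := by
  rw [harmonic_eq_sum_Icc]
  push_cast
  simp

theorem abs_sum_one_div_mul_sub_le {p : ℕ} (hp : p.Prime) {X : ℝ} (hpX : p ≤ X) :
    |∑ m ∈ Finset.Icc 1 (⌊X⌋₊ / p), (1 : ℝ) / (p * m : ℕ)
      - (Real.log X / Real.log p - 1) * primeWeight p| ≤ 1 / p := by
  have hp0 : (0 : ℝ) < p := by exact_mod_cast hp.pos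
  have hX0 : 0 < X := by linarith
  have hlp : Real.log p ≠ 0 := (Real.log_pos (by exact_mod_cast hp.one_lt)).ne'
  have h1 : ∑ m ∈ Finset.Icc 1 (⌊X⌋₊ / p), (1 : ℝ) / (p * m : ℕ) =
      1 / p * harmonic ⌊X / p⌋₊ := by
    rw [Nat.floor_div_natCast, ← sum_one_div_Icc_eq_harmonic, Finset.mul_sum]
    refine Finset.sum_congr rfl fun m _ => ?_
    push_cast
    rw [one_div_mul_one_div]
  have h2 : (Real.log X / Real.log p - 1) * primeWeight p = 1 / p * Real.log (X / p) := by
    rw [primeWeight, if_pos hp, Real.log_div hX0.ne' hp0.ne']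
    field_simp
  have h3 := log_le_harmonic_floor (X / p) (by positivity)
  have h4 := harmonic_floor_le_one_add_log (X / p) ((one_le_div hp0).2 hpX)
  rw [h1, h2, ← mul_sub, abs_mul, abs_of_pos (by positivity : (0 : ℝ) < 1 / p)]
  refine mul_le_of_le_one_right (by positivity) ?_
  rw [abs_le]
  constructor <;> linarith

theorem sum_one_div_prime_le {K : ℝ}
    (hK : ∀ t : ℝ, 1 ≤ t → |∑ k ∈ Finset.Icc 0 ⌊t⌋₊, primeWeight k - Real.log t| ≤ K)
    {y X : ℝ} (hy : 1 < y) (hyX : y ≤ X) :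
    ∑ p ∈ (Finset.Ioc ⌊y⌋₊ ⌊X⌋₊).filter Nat.Prime, (1 : ℝ) / p ≤
      (Real.log X - Real.log y + 2 * K) / Real.log y := by
  have hly : 0 < Real.log y := Real.log_pos hy
  have hle : ⌊y⌋₊ ≤ ⌊X⌋₊ := Nat.floor_le_floor hyX
  have hsplit : ∑ k ∈ Finset.Icc 0 ⌊y⌋₊, primeWeight k + ∑ k ∈ Finset.Ioc ⌊y⌋₊ ⌊X⌋₊, primeWeight k
      = ∑ k ∈ Finset.Icc 0 ⌊X⌋₊, primeWeight k := by
    rw [← Finset.sum_union]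
    · refine Finset.sum_congr ?_ fun _ _ => rfl
      ext k
      simp only [Finset.mem_union, Finset.mem_Icc, Finset.mem_Ioc]
      lia
    · rw [Finset.disjoint_left]
      intro k
      simp only [Finset.mem_Icc, Finset.mem_Ioc]
      lia
  rw [le_div_iff₀ hly]
  calc (∑ p ∈ (Finset.Ioc ⌊y⌋₊ ⌊X⌋₊).filter Nat.Prime, (1 : ℝ) / p) * Real.log y
      ≤ ∑ p ∈ (Finset.Ioc ⌊y⌋₊ ⌊X⌋₊).filter Nat.Prime, Real.log p / p := by
        rw [Finset.sum_mul]
        refine Finset.sum_le_sum fun p hp => ?_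
        simp only [Finset.mem_filter, Finset.mem_Ioc] at hp
        have h := (Nat.floor_lt (by linarith)).1 hp.1.1
        rw [one_div_mul_eq_div]
        gcongr
    _ = ∑ k ∈ Finset.Ioc ⌊y⌋₊ ⌊X⌋₊, primeWeight k := by
        rw [Finset.sum_filter]
        rfl
    _ ≤ _ := by
        have h1 := abs_le.1 (hK y hy.le)
        have h2 := abs_le.1 (hK X (hy.le.trans hyX))
        linarith

theorem stmt4 (α : ℝ) (hα : α ∈ Set.Icc (1 : ℝ) 2) :
    ∃ C : ℝ, ∀ y : ℝ, 2 ≤ y →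
      |(∑ n ∈ (Finset.Icc 2 ⌊y ^ α⌋₊).filter (fun n => y < (Pplus n : ℝ)),
          (1 : ℝ) / n)
        - (α * Real.log α - α + 1) * Real.log y| ≤ C := by
  obtain ⟨K, hK⟩ := exists_abs_sum_primeWeight_sub_log_le
  refine ⟨(α - 1 + 2 * K / Real.log 2) + 2 * K * (α - 1), fun y hy => ?_⟩
  obtain ⟨hα1, hα2⟩ := hα
  have hy0 : 0 < y := by linarith
  have hl2 : 0 < Real.log 2 := Real.log_pos one_lt_two
  have hl2y : Real.log 2 ≤ Real.log y := Real.log_le_log two_pos hy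
  have hly : 0 < Real.log y := hl2.trans_le hl2y
  have hK0 : 0 ≤ K := (abs_nonneg _).trans (hK 1 le_rfl)
  have hyX : y ≤ y ^ α := Real.self_le_rpow_of_one_le (by linarith) hα1
  have hlogX : Real.log (y ^ α) = α * Real.log y := Real.log_rpow hy0 α
  have hN : ⌊y ^ α⌋₊ < (⌊y⌋₊ + 1) ^ 2 := by
    rw [Nat.floor_lt (by positivity)]
    push_cast
    calc y ^ α ≤ y ^ (2 : ℝ) := Real.rpow_le_rpow_of_exponent_le (by linarith) hα2
      _ = y ^ 2 := by norm_cast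
      _ < _ := by
        gcongr
        exact Nat.lt_floor_add_one y
  have hfilter : (Finset.Icc 2 ⌊y ^ α⌋₊).filter (fun n => y < (Pplus n : ℝ)) =
      (Finset.Icc 2 ⌊y ^ α⌋₊).filter (fun n => ⌊y⌋₊ < Pplus n) :=
    Finset.filter_congr fun n _ => (Nat.floor_lt hy0.le).symm
  rw [hfilter, sum_inv_filter_lt_Pplus hN]
  have hmain := abs_sum_div_log_sub_one_mul_primeWeight_sub_le hK (by linarith : 1 < y) hyX
  have hα' : Real.log (y ^ α) / Real.log y = α := by
    rw [hlogX]
    field_simp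
  rw [hα', ← Real.log_div (by rw [hlogX]; positivity) hly.ne', hα', hlogX] at hmain
  have hfilt : ∑ k ∈ Finset.Ioc ⌊y⌋₊ ⌊y ^ α⌋₊,
        (α * Real.log y / Real.log k - 1) * primeWeight k =
      ∑ p ∈ (Finset.Ioc ⌊y⌋₊ ⌊y ^ α⌋₊).filter Nat.Prime,
        (Real.log (y ^ α) / Real.log p - 1) * primeWeight p := by
    rw [Finset.sum_filter, hlogX]
    refine Finset.sum_congr rfl fun k _ => ?_
    split_ifs with hk
    · rfl
    · simp [primeWeight, hk]
  rw [hfilt] at hmain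
  have hrec := sum_one_div_prime_le hK (by linarith : 1 < y) hyX
  have hrec' : (Real.log (y ^ α) - Real.log y + 2 * K) / Real.log y ≤
      α - 1 + 2 * K / Real.log 2 := by
    rw [add_div, sub_div, hα', div_self hly.ne']
    gcongr
  have hdiff : |∑ p ∈ (Finset.Ioc ⌊y⌋₊ ⌊y ^ α⌋₊).filter Nat.Prime,
        ∑ m ∈ Finset.Icc 1 (⌊y ^ α⌋₊ / p), (1 : ℝ) / (p * m : ℕ) -
      ∑ p ∈ (Finset.Ioc ⌊y⌋₊ ⌊y ^ α⌋₊).filter Nat.Prime,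
        (Real.log (y ^ α) / Real.log p - 1) * primeWeight p| ≤
      ∑ p ∈ (Finset.Ioc ⌊y⌋₊ ⌊y ^ α⌋₊).filter Nat.Prime, (1 : ℝ) / p := by
    rw [← Finset.sum_sub_distrib]
    refine (Finset.abs_sum_le_sum_abs _ _).trans (Finset.sum_le_sum fun p hp => ?_)
    simp only [Finset.mem_filter, Finset.mem_Ioc] at hp
    exact abs_sum_one_div_mul_sub_le hp.2 ((Nat.le_floor_iff (by positivity)).1 hp.1.2)
  have h1 := abs_le.1 hmain
  have h2 := abs_le.1 hdiff
  rw [abs_le]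
  constructor <;> linarith
end

section
/- For each fixed α ∈ [1,2] there is a constant C such that for all real y ≥ 2: |Ψ(y^α, y)/y^α − (1 − log α)| ≤ C/ log y. -/
open Real Finset

/-- `Ψ(x, y)`: the number of positive integers `n ≤ x` all of whose prime
factors are at most `y` (counting `n = 1`). -/
noncomputable def Psi (x y : ℝ) : ℕ :=
  ((Finset.Icc 1 ⌊x⌋₊).filter (fun n => (Pplus n : ℝ) ≤ y)).card

/-- The weights `log p / p` on the primes. -/
noncomputable def primeLogWeight (k : ℕ) : ℝ := if k.Prime then Real.log k / k else 0

theorem log_factorial_eq_sum_prime (N : ℕ) :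
    Real.log N.factorial =
      ∑ p ∈ (Icc 0 N).filter Nat.Prime, (N.factorial.factorization p : ℝ) * Real.log p := by
  rw [Real.log_nat_eq_sum_factorization, Finsupp.sum]
  refine Finset.sum_subset (fun p hp => ?_) fun p _ hp => ?_
  · rw [Nat.support_factorization] at hp
    have hpp := Nat.prime_of_mem_primeFactors hp
    simp only [mem_filter, mem_Icc]
    exact ⟨⟨Nat.zero_le _, (hpp.dvd_factorial).1 (Nat.dvd_of_mem_primeFactors hp)⟩, hpp⟩
  · rw [Finsupp.notMem_support_iff.1 hp]
    simp

theorem div_le_factorization_factorial {p : ℕ} (hp : p.Prime) (N : ℕ) :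
    N / p ≤ N.factorial.factorization p := by
  rw [Nat.factorization_factorial hp
    (show Nat.log p N < Nat.log p N + 2 by omega)]
  calc N / p = N / p ^ 1 := by rw [pow_one]
    _ ≤ _ := Finset.single_le_sum (f := fun i => N / p ^ i) (fun _ _ => Nat.zero_le _)
      (by simp)

theorem log_factorial_le_mul_log (N : ℕ) : Real.log N.factorial ≤ N * Real.log N := by
  rw [← Real.log_pow]
  exact Real.log_le_log (by exact_mod_cast N.factorial_pos) (by exact_mod_cast N.factorial_le_pow)

theorem mul_log_sub_le_log_factorial (N : ℕ) :
    N * Real.log N - N ≤ Real.log N.factorial := by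
  rcases eq_or_ne N 0 with rfl | hN
  · simp
  have h := Stirling.le_log_factorial_stirling hN
  have h1 : 0 ≤ Real.log N := Real.log_natCast_nonneg N
  have h2 : 0 ≤ Real.log (2 * π) := Real.log_nonneg (by linarith [Real.pi_gt_three])
  linarith

theorem sum_primeLogWeight_eq (N : ℕ) :
    ∑ k ∈ Icc 0 N, primeLogWeight k = ∑ p ∈ (Icc 0 N).filter Nat.Prime, Real.log p / p := by
  rw [Finset.sum_filter]; rfl

theorem sum_primeLogWeight_le {N : ℕ} (hN : N ≠ 0) :
    ∑ k ∈ Icc 0 N, primeLogWeight k ≤ Real.log N + Real.log 4 := by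
  have hN0 : (0 : ℝ) < N := by positivity
  have h1 : (N : ℝ) * ∑ k ∈ Icc 0 N, primeLogWeight k - Chebyshev.theta N
      ≤ Real.log N.factorial := by
    rw [log_factorial_eq_sum_prime, sum_primeLogWeight_eq, Chebyshev.theta_eq_sum_Icc,
      Nat.floor_natCast, Finset.mul_sum, ← Finset.sum_sub_distrib]
    refine Finset.sum_le_sum fun p hp => ?_
    have hpp := (mem_filter.1 hp).2
    have h2 : (N : ℝ) / p - 1 ≤ (N.factorial.factorization p : ℝ) := by
      have h3 : (((N / p : ℕ)) : ℝ) ≤ (N.factorial.factorization p : ℝ) := by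
        exact_mod_cast div_le_factorization_factorial hpp N
      have h4 := Nat.sub_one_lt_floor ((N : ℝ) / p)
      rw [Nat.floor_div_eq_div] at h4
      linarith
    have h5 := mul_le_mul_of_nonneg_right h2 (Real.log_natCast_nonneg p)
    calc _ = ((N : ℝ) / p - 1) * Real.log p := by ring
      _ ≤ _ := h5
  have h2 := Chebyshev.theta_le_log4_mul_x (x := N) hN0.le
  have h3 := log_factorial_le_mul_log N
  refine le_of_mul_le_mul_left ?_ hN0
  linarith

theorem exists_sum_log_div_mul_sub_one_le :
    ∃ K : ℝ, 0 ≤ K ∧ ∀ s : Finset ℕ, (∀ p ∈ s, p.Prime) →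
      ∑ p ∈ s, Real.log p / (p * (p - 1)) ≤ K := by
  have hs : Summable fun n : ℕ => 4 * (1 / (n : ℝ) ^ (3 / 2 : ℝ)) :=
    (Real.summable_one_div_nat_rpow.2 (by norm_num)).mul_left 4
  refine ⟨∑' n : ℕ, 4 * (1 / (n : ℝ) ^ (3 / 2 : ℝ)), tsum_nonneg fun n => by positivity,
    fun s hp => le_trans (Finset.sum_le_sum fun p hps => ?_)
      (hs.sum_le_tsum s fun n _ => by positivity)⟩
  have h2 : (2 : ℝ) ≤ p := by exact_mod_cast (hp p hps).two_le
  have hlog := Real.log_le_rpow_div (x := p) (ε := 1 / 2) (by linarith) (by norm_num)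
  have hpow : (p : ℝ) ^ (1 / 2 : ℝ) * (p : ℝ) ^ (3 / 2 : ℝ) = (p : ℝ) * p := by
    rw [← Real.rpow_add (by linarith)]
    norm_num
    ring
  have h3 : (0 : ℝ) < (p : ℝ) ^ (3 / 2 : ℝ) := Real.rpow_pos_of_pos (by linarith) _
  rw [mul_one_div, div_le_div_iff₀ (by nlinarith) h3]
  calc Real.log p * (p : ℝ) ^ (3 / 2 : ℝ)
      ≤ (p : ℝ) ^ (1 / 2 : ℝ) / (1 / 2) * (p : ℝ) ^ (3 / 2 : ℝ) := by gcongr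
    _ = 2 * ((p : ℝ) ^ (1 / 2 : ℝ) * (p : ℝ) ^ (3 / 2 : ℝ)) := by ring
    _ = 2 * (p * p) := by rw [hpow]
    _ ≤ 4 * (p * (p - 1)) := by nlinarith

theorem exists_le_sum_primeLogWeight :
    ∃ K : ℝ, 0 ≤ K ∧ ∀ N : ℕ, N ≠ 0 →
      Real.log N - K ≤ ∑ k ∈ Icc 0 N, primeLogWeight k := by
  obtain ⟨K, hK, h⟩ := exists_sum_log_div_mul_sub_one_le
  refine ⟨K + 1, by linarith, fun N hN => ?_⟩
  have hN0 : (0 : ℝ) < N := by positivity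
  have h1 : Real.log N.factorial ≤ N * (∑ k ∈ Icc 0 N, primeLogWeight k +
      ∑ p ∈ (Icc 0 N).filter Nat.Prime, Real.log p / (p * (p - 1))) := by
    rw [log_factorial_eq_sum_prime, sum_primeLogWeight_eq, ← Finset.sum_add_distrib,
      Finset.mul_sum]
    refine Finset.sum_le_sum fun p hp => ?_
    have hpp := (mem_filter.1 hp).2
    have h2 : (2 : ℝ) ≤ p := by exact_mod_cast hpp.two_le
    have h3 : (N.factorial.factorization p : ℝ) ≤ (N : ℝ) / (p - 1) := by
      have h4 : (N.factorial.factorization p : ℝ) ≤ ((N / (p - 1) : ℕ) : ℝ) := by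
        exact_mod_cast Nat.factorization_factorial_le_div_pred hpp N
      have h5 := Nat.cast_div_le (α := ℝ) (m := N) (n := p - 1)
      rw [Nat.cast_sub hpp.one_le, Nat.cast_one] at h5
      exact h4.trans h5
    have h6 := mul_le_mul_of_nonneg_right h3 (Real.log_natCast_nonneg p)
    refine h6.trans_eq ?_
    have : (p : ℝ) - 1 ≠ 0 := by linarith
    field_simp
    ring
  have h2 := h ((Icc 0 N).filter Nat.Prime) fun p hp => (mem_filter.1 hp).2
  have h3 := mul_log_sub_le_log_factorial N
  have h4 := mul_le_mul_of_nonneg_left h2 hN0.le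
  refine le_of_mul_le_mul_left ?_ hN0
  linarith

/-- Mertens' first theorem. -/
theorem exists_abs_sum_primeLogWeight_sub_log_le :
    ∃ K : ℝ, 0 ≤ K ∧ ∀ t : ℝ, 1 ≤ t →
      |∑ k ∈ Icc 0 ⌊t⌋₊, primeLogWeight k - Real.log t| ≤ K := by
  obtain ⟨K, hK, h⟩ := exists_le_sum_primeLogWeight
  refine ⟨K + Real.log 4, add_nonneg hK (Real.log_nonneg (by norm_num)), fun t ht => ?_⟩
  have hf : 1 ≤ ⌊t⌋₊ := (Nat.one_le_floor_iff t).2 ht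
  have hf' : (1 : ℝ) ≤ ⌊t⌋₊ := by exact_mod_cast hf
  have h1 := h ⌊t⌋₊ (by omega)
  have h2 := sum_primeLogWeight_le (N := ⌊t⌋₊) (by omega)
  have h3 : Real.log ⌊t⌋₊ ≤ Real.log t :=
    Real.log_le_log (by linarith) (Nat.floor_le (by linarith))
  have h4 : Real.log t ≤ Real.log 4 + Real.log ⌊t⌋₊ := by
    rw [← Real.log_mul (by norm_num) (by positivity)]
    exact Real.log_le_log (by linarith) (by linarith [Nat.lt_floor_add_one t])
  rw [abs_le]
  constructor <;> linarith

theorem hasDerivAt_inv_log {t : ℝ} (ht : 1 < t) :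
    HasDerivAt (fun t => (Real.log t)⁻¹) (-t⁻¹ / Real.log t ^ 2) t :=
  (Real.hasDerivAt_log (by linarith)).inv (Real.log_pos ht).ne'

theorem continuousOn_deriv_inv_log {y x : ℝ} (hy : 1 < y) :
    ContinuousOn (fun t => -t⁻¹ / Real.log t ^ 2) (Set.Icc y x) := by
  intro t ht
  have ht1 : 1 < t := lt_of_lt_of_le hy ht.1
  have h0 : t ≠ 0 := by linarith
  have hl : Real.log t ^ 2 ≠ 0 := pow_ne_zero _ (Real.log_pos ht1).ne'
  exact ContinuousAt.continuousWithinAt (by fun_prop (disch := assumption))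

theorem integral_deriv_inv_log_mul_log_add (c : ℝ) {y x : ℝ} (hy : 1 < y) (hyx : y ≤ x) :
    ∫ t in Set.Ioc y x, -t⁻¹ / Real.log t ^ 2 * (Real.log t + c) =
      (-Real.log (Real.log x) + c * (Real.log x)⁻¹) -
        (-Real.log (Real.log y) + c * (Real.log y)⁻¹) := by
  rw [← intervalIntegral.integral_of_le hyx]
  refine intervalIntegral.integral_eq_sub_of_hasDerivAt (f := fun t =>
    -Real.log (Real.log t) + c * (Real.log t)⁻¹) (fun t ht => ?_) ?_
  · rw [Set.uIcc_of_le hyx] at ht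
    have ht1 : 1 < t := lt_of_lt_of_le hy ht.1
    have hl := (Real.log_pos ht1).ne'
    have h0 : t ≠ 0 := by linarith
    have h := ((Real.hasDerivAt_log h0).log hl).neg.add ((hasDerivAt_inv_log ht1).const_mul c)
    convert! h using 1
    field_simp
    ring
  · refine ContinuousOn.intervalIntegrable ?_
    rw [Set.uIcc_of_le hyx]
    refine (continuousOn_deriv_inv_log hy).mul ((ContinuousOn.log continuousOn_id
      fun t ht => ?_).add continuousOn_const)
    have := ht.1
    simp only [id]
    linarith

/-- Mertens' second theorem on an interval. -/
theorem exists_abs_sum_prime_inv_sub_le :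
    ∃ K : ℝ, 0 ≤ K ∧ ∀ y x : ℝ, 1 < y → y ≤ x →
      |∑ p ∈ (Ioc ⌊y⌋₊ ⌊x⌋₊).filter Nat.Prime, (p : ℝ)⁻¹ -
        (Real.log (Real.log x) - Real.log (Real.log y))| ≤ K / Real.log y := by
  obtain ⟨K, hK, h⟩ := exists_abs_sum_primeLogWeight_sub_log_le
  refine ⟨2 * K, by linarith, fun y x hy hyx => ?_⟩
  have hly := Real.log_pos hy
  have hlx := Real.log_pos (hy.trans_le hyx)
  have hderiv : ∀ t ∈ Set.Icc y x,
      deriv (fun t => (Real.log t)⁻¹) t = -t⁻¹ / Real.log t ^ 2 := fun t ht =>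
    (hasDerivAt_inv_log (hy.trans_le ht.1)).deriv
  have hint : MeasureTheory.IntegrableOn (fun t => -t⁻¹ / Real.log t ^ 2) (Set.Icc y x) :=
    (continuousOn_deriv_inv_log hy).integrableOn_Icc
  have habel := sum_mul_eq_sub_sub_integral_mul (f := fun t => (Real.log t)⁻¹) primeLogWeight
    (by linarith : (0 : ℝ) ≤ y) hyx
    (fun t ht => (hasDerivAt_inv_log (hy.trans_le ht.1)).differentiableAt)
    (hint.congr_fun (fun t ht => (hderiv t ht).symm) measurableSet_Icc)
  rw [MeasureTheory.setIntegral_congr_fun (g := fun t => -t⁻¹ / Real.log t ^ 2 *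
    ∑ k ∈ Icc 0 ⌊t⌋₊, primeLogWeight k) measurableSet_Ioc
    (fun t ht => by simp only [hderiv t (Set.Ioc_subset_Icc_self ht)])] at habel
  have hsum : ∑ k ∈ Ioc ⌊y⌋₊ ⌊x⌋₊, (Real.log k)⁻¹ * primeLogWeight k =
      ∑ p ∈ (Ioc ⌊y⌋₊ ⌊x⌋₊).filter Nat.Prime, (p : ℝ)⁻¹ := by
    rw [Finset.sum_filter]
    refine Finset.sum_congr rfl fun p _ => ?_
    unfold primeLogWeight
    split_ifs with hp
    · have : Real.log p ≠ 0 := (Real.log_pos (by exact_mod_cast hp.one_lt)).ne'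
      field_simp
    · simp
  rw [hsum] at habel
  have hintA : MeasureTheory.IntegrableOn (fun t => -t⁻¹ / Real.log t ^ 2 *
      ∑ k ∈ Icc 0 ⌊t⌋₊, primeLogWeight k) (Set.Ioc y x) :=
    (integrableOn_mul_sum_Icc _ (by linarith) hint).mono_set Set.Ioc_subset_Icc_self
  have hintL : ∀ c : ℝ, MeasureTheory.IntegrableOn (fun t => -t⁻¹ / Real.log t ^ 2 *
      (Real.log t + c)) (Set.Ioc y x) := fun c => by
    refine (ContinuousOn.integrableOn_Icc ?_).mono_set Set.Ioc_subset_Icc_self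
    refine (continuousOn_deriv_inv_log hy).mul ((ContinuousOn.log continuousOn_id
      fun t ht => ?_).add continuousOn_const)
    have := ht.1
    simp only [id]
    linarith
  have hneg : ∀ t ∈ Set.Ioc y x, -t⁻¹ / Real.log t ^ 2 ≤ 0 := fun t ht => by
    have : 0 < t := by linarith [ht.1]
    rw [neg_div]
    exact neg_nonpos.2 (by positivity)
  have hE : ∀ t ∈ Set.Ioc y x, Real.log t + -K ≤ ∑ k ∈ Icc 0 ⌊t⌋₊, primeLogWeight k ∧
      ∑ k ∈ Icc 0 ⌊t⌋₊, primeLogWeight k ≤ Real.log t + K := fun t ht => by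
    have := abs_le.1 (h t (by linarith [ht.1]))
    constructor <;> linarith
  have hup := MeasureTheory.setIntegral_mono_on hintA (hintL (-K)) measurableSet_Ioc
    fun t ht => mul_le_mul_of_nonpos_left (hE t ht).1 (hneg t ht)
  have hlo := MeasureTheory.setIntegral_mono_on (hintL K) hintA measurableSet_Ioc
    fun t ht => mul_le_mul_of_nonpos_left (hE t ht).2 (hneg t ht)
  rw [integral_deriv_inv_log_mul_log_add _ hy hyx] at hup hlo
  obtain ⟨hx1, hx2⟩ := abs_le.1 (h x (by linarith))
  obtain ⟨hy1, hy2⟩ := abs_le.1 (h y hy.le)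
  have ax1 := mul_le_mul_of_nonneg_left hx1 (inv_pos.2 hlx).le
  have ax2 := mul_le_mul_of_nonneg_left hx2 (inv_pos.2 hlx).le
  have ay1 := mul_le_mul_of_nonneg_left hy1 (inv_pos.2 hly).le
  have ay2 := mul_le_mul_of_nonneg_left hy2 (inv_pos.2 hly).le
  rw [mul_sub, inv_mul_cancel₀ hlx.ne'] at ax1 ax2
  rw [mul_sub, inv_mul_cancel₀ hly.ne'] at ay1 ay2
  rw [habel, abs_le, div_eq_mul_inv]
  constructor <;> linarith

theorem Pplus_le_iff {n : ℕ} {y : ℝ} (hy : 0 ≤ y) :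
    (Pplus n : ℝ) ≤ y ↔ ∀ p ∈ n.primeFactors, p ≤ ⌊y⌋₊ := by
  rw [← Nat.le_floor_iff hy, Pplus, Finset.sup_le_iff]
  rfl

/-- For `x ≤ y ^ 2`, an integer up to `x` has at most one prime factor exceeding `y`. -/
theorem Psi_add_sum_div_eq {x y : ℝ} (hy : 0 ≤ y) (hx : 0 ≤ x) (hxy : x ≤ y ^ 2) :
    Psi x y + ∑ p ∈ (Ioc ⌊y⌋₊ ⌊x⌋₊).filter Nat.Prime, ⌊x⌋₊ / p = ⌊x⌋₊ := by
  classical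
  have hbi : (Icc 1 ⌊x⌋₊).filter (fun n => ¬ (Pplus n : ℝ) ≤ y) =
      ((Ioc ⌊y⌋₊ ⌊x⌋₊).filter Nat.Prime).biUnion
        fun p => (Ioc 0 ⌊x⌋₊).filter (p ∣ ·) := by
    ext n
    simp only [mem_filter, mem_biUnion, Pplus_le_iff hy, mem_Icc, mem_Ioc, not_forall, not_le]
    constructor
    · rintro ⟨⟨h1, h2⟩, p, hp, hyp⟩
      have hd := Nat.dvd_of_mem_primeFactors hp
      exact ⟨p, ⟨⟨hyp, (Nat.le_of_dvd h1 hd).trans h2⟩, Nat.prime_of_mem_primeFactors hp⟩,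
        ⟨h1, h2⟩, hd⟩
    · rintro ⟨p, ⟨⟨hyp, _⟩, hp⟩, ⟨h1, h2⟩, hd⟩
      exact ⟨⟨h1, h2⟩, p, Nat.mem_primeFactors.2 ⟨hp, hd, Nat.ne_of_gt h1⟩, hyp⟩
  have hdisj : (((Ioc ⌊y⌋₊ ⌊x⌋₊).filter Nat.Prime : Finset ℕ) : Set ℕ).PairwiseDisjoint
      fun p => (Ioc 0 ⌊x⌋₊).filter (p ∣ ·) := by
    intro p hp q hq hpq
    simp only [coe_filter, mem_Ioc, Set.mem_ofPred_eq] at hp hq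
    refine Finset.disjoint_left.2 fun n hn hn' => ?_
    simp only [mem_filter, mem_Ioc] at hn hn'
    have hd := ((Nat.coprime_primes hp.2 hq.2).2 hpq).mul_dvd_of_dvd_of_dvd hn.2 hn'.2
    have hle : ((p * q : ℕ) : ℝ) ≤ x :=
      (Nat.le_floor_iff hx).1 ((Nat.le_of_dvd hn.1.1 hd).trans hn.1.2)
    have hp' : y < p := (Nat.floor_lt hy).1 hp.1.1
    have hq' : y < q := (Nat.floor_lt hy).1 hq.1.1
    push_cast at hle
    nlinarith
  have hcard := Finset.card_filter_add_card_filter_not (s := Icc 1 ⌊x⌋₊)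
    (fun n => (Pplus n : ℝ) ≤ y)
  rw [hbi, Finset.card_biUnion hdisj, Nat.card_Icc, Nat.add_sub_cancel] at hcard
  simp only [Nat.Ioc_filter_dvd_card_eq_div] at hcard
  exact hcard

theorem card_primes_Ioc_mul_log_le {x y : ℝ} (hy : 0 < y) (hx : 0 ≤ x) :
    (((Ioc ⌊y⌋₊ ⌊x⌋₊).filter Nat.Prime).card : ℝ) * Real.log y ≤ Real.log 4 * x := by
  refine le_trans ?_ (Chebyshev.theta_le_log4_mul_x hx)
  rw [Chebyshev.theta, ← nsmul_eq_mul]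
  refine le_trans (Finset.card_nsmul_le_sum _ (fun p : ℕ => Real.log p) _ fun p hp => ?_)
    (Finset.sum_le_sum_of_subset_of_nonneg
      (Finset.filter_subset_filter _ (Finset.Ioc_subset_Ioc_left (Nat.zero_le _)))
      fun p _ _ => Real.log_natCast_nonneg p)
  have := (mem_Ioc.1 (mem_filter.1 hp).1).1
  exact Real.log_le_log hy ((Nat.floor_lt hy.le).1 this).le

theorem exists_abs_Psi_div_sub_le :
    ∃ K : ℝ, ∀ y x : ℝ, 1 < y → y ≤ x → x ≤ y ^ 2 →
      |(Psi x y : ℝ) / x - (1 - (Real.log (Real.log x) - Real.log (Real.log y)))| ≤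
        K / Real.log y := by
  obtain ⟨K, hK, h⟩ := exists_abs_sum_prime_inv_sub_le
  refine ⟨K + Real.log 4 + 1, fun y x hy hyx hxy => ?_⟩
  have hy0 : 0 < y := by linarith
  have hx0 : 0 < x := by linarith
  have hly := Real.log_pos hy
  obtain ⟨hm1, hm2⟩ := abs_le.1 (h y x hy hyx)
  set P := (Ioc ⌊y⌋₊ ⌊x⌋₊).filter Nat.Prime with hP
  set S := ∑ p ∈ P, (p : ℝ)⁻¹ with hS
  have hcount : (Psi x y : ℝ) + ∑ p ∈ P, ((⌊x⌋₊ / p : ℕ) : ℝ) = ⌊x⌋₊ := by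
    exact_mod_cast Psi_add_sum_div_eq hy0.le hx0.le hxy
  have hfloor : ∀ p : ℕ, ((⌊x⌋₊ / p : ℕ) : ℝ) = ⌊x / p⌋₊ := fun p => by
    rw [Nat.floor_div_natCast]
  have hup : ∑ p ∈ P, ((⌊x⌋₊ / p : ℕ) : ℝ) ≤ x * S := by
    rw [hS, Finset.mul_sum]
    refine Finset.sum_le_sum fun p _ => ?_
    rw [hfloor, ← div_eq_mul_inv]
    exact Nat.floor_le (by positivity)
  have hlo : x * S - P.card ≤ ∑ p ∈ P, ((⌊x⌋₊ / p : ℕ) : ℝ) := by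
    rw [hS, Finset.mul_sum, Finset.card_eq_sum_ones, Nat.cast_sum, ← Finset.sum_sub_distrib]
    refine Finset.sum_le_sum fun p _ => ?_
    rw [hfloor, ← div_eq_mul_inv, Nat.cast_one]
    exact (Nat.sub_one_lt_floor _).le
  have hcard : (P.card : ℝ) ≤ x * (Real.log 4 / Real.log y) := by
    rw [← mul_div_assoc, le_div_iff₀ hly, mul_comm x]
    exact card_primes_Ioc_mul_log_le hy0 hx0.le
  have hone : 1 ≤ x * (1 / Real.log y) := by
    rw [mul_one_div, le_div_iff₀ hly]
    linarith [Real.log_le_self hy0.le]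
  have hf1 := Nat.floor_le hx0.le
  have hf2 := Nat.lt_floor_add_one x
  have hlow : 1 - S - 1 / Real.log y ≤ (Psi x y : ℝ) / x := by
    rw [le_div_iff₀ hx0]
    linarith
  have hupp : (Psi x y : ℝ) / x ≤ 1 - S + Real.log 4 / Real.log y := by
    rw [div_le_iff₀ hx0]
    linarith
  have h4 : 0 ≤ Real.log 4 / Real.log y := div_nonneg (Real.log_nonneg (by norm_num)) hly.le
  have h1 : 0 ≤ 1 / Real.log y := by positivity
  rw [abs_le, add_div, add_div]
  constructor <;> linarith

theorem stmt7 (α : ℝ) (hα : α ∈ Set.Icc (1 : ℝ) 2) :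
    ∃ C : ℝ, ∀ y : ℝ, 2 ≤ y →
      |(Psi (y ^ α) y : ℝ) / y ^ α - (1 - Real.log α)| ≤ C / Real.log y := by
  obtain ⟨K, h⟩ := exists_abs_Psi_div_sub_le
  refine ⟨K, fun y hy => ?_⟩
  have hy0 : 0 < y := by linarith
  have hly : 0 < Real.log y := Real.log_pos (by linarith)
  have hloglog : Real.log (Real.log (y ^ α)) - Real.log (Real.log y) = Real.log α := by
    rw [Real.log_rpow hy0, Real.log_mul (by linarith [hα.1]) hly.ne', add_sub_cancel_right]
  rw [← hloglog]
  refine h y (y ^ α) (by linarith) ?_ ?_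
  · simpa using Real.rpow_le_rpow_of_exponent_le (by linarith : 1 ≤ y) hα.1
  · simpa using Real.rpow_le_rpow_of_exponent_le (by linarith : 1 ≤ y) hα.2
end
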